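/- Let p ≥ 5 be a prime and let D be a nontrivial regular (8p^3, 4p^2+2p+1, 2p+4, 2p+2)-partial difference set in an Abelian group G of order 8p^3. Then the number of elements of order 2 in D is either 3 or 7. -/

import Mathlib

variable {G : Type*} [CommGroup G] [DecidableEq G] [Fintype G]

/-- The number of representations of `g` as `d₁ * d₂⁻¹` with `d₁, d₂ ∈ D`, `d₁ ≠ d₂`. -/
def pdsReps (D : Finset G) (g : G) : ℕ :=
  ((D ×ˢ D).filter (fun x => x.1 ≠ x.2 ∧ x.1 * x.2⁻¹ = g)).card

/-- `D` is a `(v,k,λ,μ)`-partial difference set in `G`. -/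
def IsPDS (D : Finset G) (v k l m : ℕ) : Prop :=
  Fintype.card G = v ∧ D.card = k ∧
  (∀ g : G, g ≠ 1 → g ∈ D → pdsReps D g = l) ∧
  (∀ g : G, g ≠ 1 → g ∉ D → pdsReps D g = m)

/-- `D` is regular: closed under inverses and not containing the identity. -/
def IsRegularPDS (D : Finset G) : Prop :=
  (∀ d ∈ D, d⁻¹ ∈ D) ∧ (1 : G) ∉ D

/-- A regular PDS is trivial if `D ∪ {e}` or `G \ D` is a subgroup. -/
def IsTrivialPDS (D : Finset G) : Prop :=
  (∃ H : Subgroup G, (H : Set G) = ↑D ∪ {1}) ∨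
  (∃ H : Subgroup G, (H : Set G) = (↑D : Set G)ᶜ)

section Arithmetic

theorem sum_sq_emod_two_eq {ι : Type*} (s : Finset ι) (y : ι → ℤ) :
    (∑ i ∈ s, y i ^ 2) % 2 = (∑ i ∈ s, y i) % 2 := by
  have h : (2 : ℤ) ∣ ∑ i ∈ s, (y i ^ 2 - y i) := by
    refine Finset.dvd_sum fun i _ => ?_
    have := (Int.even_mul_pred_self (y i)).two_dvd
    rwa [show y i ^ 2 - y i = y i * (y i - 1) by ring]
  rw [Finset.sum_sub_distrib] at h
  omega

/-- There is no integer vector of length `8` that is congruent modulo an even `q ≥ 4` to a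
vector with one entry `-1` and the others in `{0, 1}`, with entry sum `4q + 6` and square sum
`2q² + 6q + 8`. -/
theorem not_exists_coset_distribution {ι : Type*} [DecidableEq ι] (s : Finset ι) (i₀ : ι)
    (hi₀ : i₀ ∈ s) (hs : s.card = 8) (e y : ι → ℤ) (q : ℤ) (hq : 4 ≤ q) (hq2 : 2 ∣ q)
    (he₀ : e i₀ = -1) (he : ∀ i ∈ s, i ≠ i₀ → e i = 0 ∨ e i = 1)
    (hsum : ∑ i ∈ s, (e i + q * y i) = 4 * q + 6)
    (hsq : ∑ i ∈ s, (e i + q * y i) ^ 2 = 2 * q ^ 2 + 6 * q + 8) : False := by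
  have hsum' : ∑ i ∈ s, e i + q * ∑ i ∈ s, y i = 4 * q + 6 := by
    rw [← hsum, Finset.sum_add_distrib, Finset.mul_sum]
  have hsq' : ∑ i ∈ s, e i ^ 2 + 2 * q * ∑ i ∈ s, e i * y i + q ^ 2 * ∑ i ∈ s, y i ^ 2
      = 2 * q ^ 2 + 6 * q + 8 := by
    rw [← hsq, Finset.mul_sum, Finset.mul_sum, ← Finset.sum_add_distrib,
      ← Finset.sum_add_distrib]
    exact Finset.sum_congr rfl fun i _ => by ring
  have hcard : ((s.erase i₀).card : ℤ) = 7 := by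
    rw [Finset.card_erase_of_mem hi₀, hs]; norm_num
  have hA := Finset.add_sum_erase s e hi₀
  have hB := Finset.add_sum_erase s (fun i => e i ^ 2) hi₀
  rw [he₀] at hA hB
  have hBA : ∑ i ∈ s.erase i₀, e i ^ 2 = ∑ i ∈ s.erase i₀, e i := by
    refine Finset.sum_congr rfl fun i hi => ?_
    rcases he i (Finset.mem_of_mem_erase hi) (Finset.ne_of_mem_erase hi) with h | h <;>
      rw [h] <;> norm_num
  have hnonneg : 0 ≤ ∑ i ∈ s.erase i₀, e i := by
    refine Finset.sum_nonneg fun i hi => ?_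
    rcases he i (Finset.mem_of_mem_erase hi) (Finset.ne_of_mem_erase hi) with h | h <;> omega
  have hcompl : ∀ i ∈ s.erase i₀, 0 ≤ 1 - e i := by
    intro i hi
    rcases he i (Finset.mem_of_mem_erase hi) (Finset.ne_of_mem_erase hi) with h | h <;> omega
  have hcsum : ∑ i ∈ s.erase i₀, (1 - e i) = 7 - ∑ i ∈ s.erase i₀, e i := by
    rw [Finset.sum_sub_distrib, Finset.sum_const, nsmul_eq_mul, hcard, mul_one]
  have hle : 0 ≤ ∑ i ∈ s.erase i₀, (1 - e i) := Finset.sum_nonneg hcompl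
  have hpar := sum_sq_emod_two_eq s y
  have hfull : ∑ i ∈ s.erase i₀, e i = 7 →
      ∑ i ∈ s, e i * y i = ∑ i ∈ s, y i - 2 * y i₀ := by
    intro h7
    have hone := (Finset.sum_eq_zero_iff_of_nonneg hcompl).1 (by rw [hcsum, h7]; norm_num)
    rw [← Finset.add_sum_erase s (fun i => e i * y i) hi₀, ← Finset.add_sum_erase s y hi₀, he₀,
      Finset.sum_congr rfl (fun i hi => show e i * y i = y i by
        rw [show e i = 1 by linarith [hone i hi], one_mul])]
    ring
  set A := ∑ i ∈ s.erase i₀, e i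
  set Y := ∑ i ∈ s, y i
  set Q := ∑ i ∈ s, y i ^ 2
  set C := ∑ i ∈ s, e i * y i
  obtain ⟨k, rfl⟩ := hq2
  have hz : 7 - A = 2 * k * (Y - 4) := by linarith
  have hz0 : 0 ≤ Y - 4 := by
    by_contra! h
    nlinarith
  have hz1 : Y - 4 ≤ 1 := by
    by_contra! h
    nlinarith
  have hmain : -(Y - 4) + 2 * C + 2 * k * Q = 4 * k + 6 := by
    have h : 2 * k * (-(Y - 4) + 2 * C + 2 * k * Q) = 2 * k * (4 * k + 6) := by
      linarith
    exact mul_left_cancel₀ (by omega) h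
  have hY : Y = 4 := by
    have : 2 * (C + k * Q - 2 * k - 3) = Y - 4 := by linarith
    omega
  have hC := hfull (by rw [hY] at hz; linarith)
  rw [hY] at hmain hC hpar
  obtain ⟨Q', hQ'⟩ : (2 : ℤ) ∣ Q := by omega
  rw [hQ', hC] at hmain
  have : 4 * (-y i₀ + k * Q' - k) = -2 := by linarith
  omega

end Arithmetic

section Counting

/-- If all orbits of `f` have length exactly `n`, then `n` divides the number of points. -/
theorem dvd_card_of_iterate_eq_self_iff {X : Type*} [Fintype X] (f : X → X) (n : ℕ) (hn : 0 < n)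
    (hf : ∀ x, f^[n] x = x) (hfree : ∀ x i, f^[i] x = x → n ∣ i) : n ∣ Fintype.card X := by
  classical
  rcases isEmpty_or_nonempty X with hX | ⟨⟨x₀⟩⟩
  · simp
  obtain ⟨m, rfl⟩ : ∃ m, n = m + 1 := ⟨n - 1, by omega⟩
  let σ : Equiv.Perm X :=
    { toFun := f
      invFun := f^[m]
      left_inv := fun x => by rw [← Function.iterate_succ_apply]; exact hf x
      right_inv := fun x => (Function.iterate_succ_apply' f m x).symm.trans (hf x) }
  have hσ : ∀ i x, (σ ^ i) x = f^[i] x := fun i x => by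
    rw [Equiv.Perm.coe_pow]; rfl
  have hpow : σ ^ (m + 1) = 1 := Equiv.ext fun x => by rw [hσ, hf]; rfl
  have hstab : ∀ x : X, MulAction.stabilizer (Subgroup.zpowers σ) x = ⊥ := by
    intro x
    rw [eq_bot_iff]
    rintro ⟨τ, hτ⟩ hx
    obtain ⟨i, rfl⟩ := (mem_powers_iff_mem_zpowers (x := σ)).2 hτ
    have hx' : (σ ^ i) x = x := hx
    rw [hσ] at hx'
    obtain ⟨j, rfl⟩ := hfree x i hx'
    rw [Subgroup.mem_bot, Subtype.ext_iff]
    change σ ^ ((m + 1) * j) = 1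
    rw [pow_mul, hpow, one_pow]
  have hcard := Nat.card_congr (MulAction.selfEquivOrbitsQuotientProd hstab)
  rw [Nat.card_prod, Nat.card_zpowers, Nat.card_eq_fintype_card] at hcard
  have hord : m + 1 ∣ orderOf σ := hfree x₀ _ (by rw [← hσ, pow_orderOf_eq_one]; rfl)
  rw [hcard]
  exact hord.mul_left _

end Counting

section PrimitiveRoot

/-- An exponent acting trivially on elements of order dividing `8` whose action on `p`-elements is
that of a Teichmüller representative of a primitive root. -/
theorem exists_teichmuller_exponent (p : ℕ) (hp : p.Prime) (hp2 : p ≠ 2) :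
    ∃ r : ℕ, r.Coprime (8 * p ^ 3) ∧ r ≡ 1 [MOD 8] ∧ r ^ (p - 1) ≡ 1 [MOD 8 * p ^ 3] ∧
      ∀ i, r ^ i ≡ 1 [MOD p] → p - 1 ∣ i := by
  have := Fact.mk hp
  have hp2' : Nat.Coprime 2 p := (Nat.coprime_primes Nat.prime_two hp).2 hp2.symm
  have hcop : Nat.Coprime 8 (p ^ 3) := by
    rw [show 8 = 2 ^ 3 by norm_num]; exact Nat.Coprime.pow _ _ hp2'
  obtain ⟨g, hg⟩ := IsCyclic.exists_generator (α := (ZMod p)ˣ)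
  have hgord : orderOf g = p - 1 := by
    rw [orderOf_eq_card_of_forall_mem_zpowers hg, Nat.card_eq_fintype_card,
      ZMod.card_units_eq_totient, Nat.totient_prime hp]
  set a : ℕ := (g : ZMod p).val with ha
  have hacast : (a : ZMod p) = (g : ZMod p) := by rw [ha, ZMod.natCast_val, ZMod.cast_id]
  have hacop : a.Coprime p := by
    rw [← ZMod.isUnit_iff_coprime, hacast]; exact g.isUnit
  obtain ⟨r, hr8, hrp⟩ := Nat.chineseRemainder hcop 1 (a ^ (p ^ 2))
  have hrcop8 : r.Coprime 8 := by
    have := hr8.gcd_eq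
    simpa [Nat.Coprime] using this
  have hrcopp : r.Coprime (p ^ 3) := by
    have := hrp.gcd_eq
    rw [Nat.Coprime, this]
    exact Nat.Coprime.pow _ _ hacop
  refine ⟨r, hrcop8.mul_right hrcopp, hr8, ?_, ?_⟩
  · rw [← Nat.modEq_and_modEq_iff_modEq_mul hcop]
    refine ⟨by simpa using hr8.pow (p - 1), (hrp.pow (p - 1)).trans ?_⟩
    have := Nat.ModEq.pow_totient (hacop.pow_right 3)
    rwa [Nat.totient_prime_pow_succ hp, pow_mul] at this
  · intro i hi
    have hrp' : r ≡ a ^ p ^ 2 [MOD p] := hrp.of_dvd (dvd_pow_self p (by norm_num))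
    have hra : (r : ZMod p) = (g : ZMod p) := by
      rw [(ZMod.natCast_eq_natCast_iff _ _ _).2 hrp', Nat.cast_pow, hacast, pow_two, pow_mul,
        ZMod.pow_card, ZMod.pow_card]
    rw [← hgord]
    apply orderOf_dvd_of_pow_eq_one
    have := (ZMod.natCast_eq_natCast_iff _ _ _).2 hi
    rw [Nat.cast_pow, hra, Nat.cast_one] at this
    exact Units.ext (by simpa using this)

end PrimitiveRoot

section GroupRing

variable {A : Type*} [CommRing A]

/-- Odd powers of a solution `E` of `E² = a + cJ`, where `J` absorbs `E` and itself. -/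
theorem exists_odd_pow_eq {R : Type*} [CommRing R] [Algebra R A] (E J : A) (a c n k : R)
    (hE : E ^ 2 = algebraMap R A a + c • J) (hJ : J * J = n • J) (hEJ : E * J = k • J) (m : ℕ) :
    ∃ c' : R, E ^ (2 * m + 1) = a ^ m • E + c' • J := by
  induction m with
  | zero => exact ⟨0, by simp⟩
  | succ m ih =>
    obtain ⟨c', hc'⟩ := ih
    refine ⟨a ^ m * c * k + c' * a + c' * c * n, ?_⟩
    rw [show 2 * (m + 1) + 1 = (2 * m + 1) + 2 by ring, pow_add, hc', hE]
    simp only [Algebra.smul_def, map_add, map_mul, map_pow] at hJ hEJ ⊢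
    linear_combination (algebraMap R A a ^ m * algebraMap R A c) * hEJ +
      algebraMap R A c' * algebraMap R A c * hJ

theorem MonoidAlgebra.coeff_sum_single {R X : Type*} [CommRing R] [Fintype X] [DecidableEq X]
    (f : X → X) (a : X → R) (h : X) :
    (∑ g, MonoidAlgebra.single (f g) (a g)).coeff h = ∑ g with f g = h, a g := by
  rw [MonoidAlgebra.coeff_sum, Finsupp.finsetSum_apply, Finset.sum_filter]
  refine Finset.sum_congr rfl fun g _ => ?_
  rw [MonoidAlgebra.coeff_single, Finsupp.single_apply]

theorem MonoidAlgebra.sum_single_mul_sum_single {R H : Type*} [CommRing R] [CommGroup H]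
    [Fintype H] (a b : H → R) :
    (∑ g, MonoidAlgebra.single g (a g)) * ∑ g, MonoidAlgebra.single g (b g) =
      ∑ x, MonoidAlgebra.single x (∑ g, a g * b (g⁻¹ * x)) := by
  rw [Finset.sum_mul_sum]
  simp_rw [MonoidAlgebra.single_mul_single, ← MonoidAlgebra.singleAddHom_apply, map_sum]
  rw [Finset.sum_comm (s := Finset.univ) (t := Finset.univ) (f := fun x g =>
    MonoidAlgebra.singleAddHom x (a g * b (g⁻¹ * x)))]
  refine Finset.sum_congr rfl fun g _ => ?_
  exact Fintype.sum_equiv (Equiv.mulLeft g) _ _ fun x => by simp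

instance MonoidAlgebra.instCharP {M : Type*} [CommMonoid M] (q : ℕ) [CharP A q] :
    CharP (MonoidAlgebra A M) q :=
  charP_of_injective_algebraMap (R := A)
    (fun x y h => by
      have := congrArg (fun z => MonoidAlgebra.coeff z 1) h
      simpa using this) q

/-- An integer-valued function on `G` with autocorrelation `a·δ + c`, reduced modulo a prime:
its image under a Frobenius power map is `aᵐ` times itself plus a constant. -/
theorem exists_frobenius_fiber_sum (e : G → ℤ) (a c : ℤ)
    (he : ∀ x, ∑ g, e g * e (g⁻¹ * x) = (if x = 1 then a else 0) + c)
    (q : ℕ) (hq : q.Prime) (n m : ℕ) (hm : q ^ n = 2 * m + 1) :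
    ∃ c' : ZMod q, ∀ h : G, ∑ g with g ^ (q ^ n) = h, (e g : ZMod q) =
      (a : ZMod q) ^ m * e h + c' := by
  have := Fact.mk hq
  let E : MonoidAlgebra (ZMod q) G := ∑ g, MonoidAlgebra.single g (e g : ZMod q)
  let J : MonoidAlgebra (ZMod q) G := ∑ g, MonoidAlgebra.single g 1
  have hJ : ∀ b : G → ZMod q, (∑ g, MonoidAlgebra.single g (b g)) * J = (∑ g, b g) • J := by
    intro b
    rw [MonoidAlgebra.sum_single_mul_sum_single, Finset.smul_sum]
    simp
  have hE : E ^ 2 = algebraMap (ZMod q) _ (a : ZMod q) + (c : ZMod q) • J := by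
    rw [pow_two, MonoidAlgebra.sum_single_mul_sum_single, Finset.smul_sum]
    have h1 : algebraMap (ZMod q) (MonoidAlgebra (ZMod q) G) (a : ZMod q) =
        ∑ x, MonoidAlgebra.single x (if x = 1 then (a : ZMod q) else 0) := by
      rw [Finset.sum_eq_single 1]
      · rw [if_pos rfl, MonoidAlgebra.coe_algebraMap]; rfl
      · intro x _ hx; simp [hx]
      · simp
    rw [h1, ← Finset.sum_add_distrib]
    refine Finset.sum_congr rfl fun x _ => ?_
    rw [MonoidAlgebra.smul_single, ← MonoidAlgebra.single_add]
    congr 1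
    have := congrArg (Int.cast : ℤ → ZMod q) (he x)
    push_cast at this
    simpa using this
  obtain ⟨c', hc'⟩ := exists_odd_pow_eq E J (a : ZMod q) (c : ZMod q) _ _ hE (hJ _) (hJ _) m
  refine ⟨c', fun h => ?_⟩
  have hfrob : E ^ (q ^ n) = ∑ g, MonoidAlgebra.single (g ^ q ^ n) (e g : ZMod q) := by
    rw [← iterateFrobenius_def q n E, map_sum]
    refine Finset.sum_congr rfl fun g _ => ?_
    rw [iterateFrobenius_def, MonoidAlgebra.single_pow, ZMod.pow_card_pow]
  rw [← MonoidAlgebra.coeff_sum_single, ← hfrob, hm, hc', MonoidAlgebra.coeff_add,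
    MonoidAlgebra.coeff_smul, MonoidAlgebra.coeff_smul]
  simp only [Finsupp.add_apply, Finsupp.smul_apply, smul_eq_mul]
  have hEh : E.coeff h = e h :=
    (MonoidAlgebra.coeff_sum_single id _ h).trans (by simp [Finset.filter_eq'])
  have hJh : J.coeff h = 1 :=
    (MonoidAlgebra.coeff_sum_single id _ h).trans (by simp [Finset.filter_eq'])
  rw [hEh, hJh, mul_one]

end GroupRing

section ShiftedIndicator

/-- The coefficients of the group ring element `D - 1`. -/
def shiftedIndicator (D : Finset G) (g : G) : ℤ :=
  (if g ∈ D then 1 else 0) - (if g = 1 then 1 else 0)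

omit [Fintype G] in
theorem shiftedIndicator_one {D : Finset G} (hD : (1 : G) ∉ D) : shiftedIndicator D 1 = -1 := by
  simp [shiftedIndicator, hD]

omit [Fintype G] in
theorem shiftedIndicator_of_ne_one (D : Finset G) {g : G} (hg : g ≠ 1) :
    shiftedIndicator D g = if g ∈ D then 1 else 0 := by
  simp [shiftedIndicator, hg]

omit [Fintype G] in
theorem shiftedIndicator_inv {D : Finset G} (hreg : IsRegularPDS D) (g : G) :
    shiftedIndicator D g⁻¹ = shiftedIndicator D g := by
  have h : g⁻¹ ∈ D ↔ g ∈ D := ⟨fun h => by simpa using hreg.1 _ h, hreg.1 g⟩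
  simp [shiftedIndicator, h]

theorem sum_shiftedIndicator (D : Finset G) : ∑ g, shiftedIndicator D g = (D.card : ℤ) - 1 := by
  simp [shiftedIndicator, Finset.sum_sub_distrib]

theorem sum_indicator_mul_indicator {D : Finset G} (hreg : IsRegularPDS D) (x : G) :
    ∑ g, (if g ∈ D then (1 : ℤ) else 0) * (if g⁻¹ * x ∈ D then 1 else 0) =
      if x = 1 then (D.card : ℤ) else pdsReps D x := by
  have hinv : ∀ g : G, g⁻¹ ∈ D ↔ g ∈ D := fun g =>
    ⟨fun h => by simpa using hreg.1 _ h, hreg.1 g⟩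
  simp_rw [ite_zero_mul_ite_zero, mul_one]
  rw [Finset.sum_boole]
  split_ifs with hx
  · subst hx
    congr 2
    ext g
    simp [hinv]
  · rw [pdsReps]
    congr 1
    refine Finset.card_bij' (fun g _ => (g, x⁻¹ * g)) (fun y _ => y.1) ?_ ?_ ?_ ?_
    · intro g hg
      simp only [Finset.mem_filter, Finset.mem_univ, true_and, Finset.mem_product] at hg ⊢
      refine ⟨⟨hg.1, ?_⟩, ?_, ?_⟩
      · rw [← hinv]; simpa [mul_comm] using hg.2
      · intro h
        exact hx (by simpa using h)
      · simp
    · rintro ⟨a, b⟩ hy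
      simp only [Finset.mem_filter, Finset.mem_univ, true_and, Finset.mem_product] at hy ⊢
      obtain ⟨⟨ha, hb⟩, -, rfl⟩ := hy
      exact ⟨ha, by simpa using (hinv b).2 hb⟩
    · intro g _; rfl
    · rintro ⟨a, b⟩ hy
      simp only [Finset.mem_filter, Finset.mem_product] at hy
      obtain ⟨-, -, rfl⟩ := hy
      simp

/-- When `λ - μ = 2`, the element `D - 1` of the group ring squares to `(k - μ + 1) + μ G`. -/
theorem shiftedIndicator_autocorrelation {D : Finset G} {v k m : ℕ} (hD : IsPDS D v k (m + 2) m)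
    (hreg : IsRegularPDS D) (x : G) :
    ∑ g, shiftedIndicator D g * shiftedIndicator D (g⁻¹ * x) =
      (if x = 1 then (k : ℤ) - m + 1 else 0) + m := by
  have h1 : ∀ g, shiftedIndicator D g * shiftedIndicator D (g⁻¹ * x) =
      (if g ∈ D then (1 : ℤ) else 0) * (if g⁻¹ * x ∈ D then 1 else 0)
      - (if g = x then (if g ∈ D then 1 else 0) else 0)
      - (if g = 1 then (if g⁻¹ * x ∈ D then 1 else 0) else 0)
      + (if g = 1 then (if g⁻¹ * x = 1 then 1 else 0) else 0) := by
    intro g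
    have : g⁻¹ * x = 1 ↔ g = x := by rw [inv_mul_eq_one]
    simp only [shiftedIndicator, this]
    split_ifs <;> simp
  simp_rw [h1]
  rw [Finset.sum_add_distrib, Finset.sum_sub_distrib, Finset.sum_sub_distrib,
    sum_indicator_mul_indicator hreg]
  simp only [Finset.sum_ite_eq', Finset.mem_univ, if_true, inv_one, one_mul]
  by_cases hx : x = 1
  · subst hx
    simp [hreg.2, hD.2.1]
    ring
  · by_cases hxD : x ∈ D
    · simp [hx, hxD, hD.2.2.1 x hx hxD]
      ring
    · simp [hx, hxD, hD.2.2.2 x hx hxD]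

end ShiftedIndicator

section Multiplier

/-- Every exponent prime to the group order is a multiplier. -/
theorem shiftedIndicator_pow {D : Finset G} (p : ℕ) (c : ℤ)
    (h2 : 2 ∣ Nat.card G) (hpG : p ∣ Nat.card G)
    (hauto : ∀ x, ∑ g, shiftedIndicator D g * shiftedIndicator D (g⁻¹ * x) =
      (if x = 1 then (2 * p : ℤ) ^ 2 else 0) + c)
    (r : ℕ) (hr : r.Coprime (Nat.card G)) (g : G) :
    shiftedIndicator D (g ^ r) = shiftedIndicator D g := by
  induction r using induction_on_primes generalizing g with
  | zero =>
    rw [Nat.coprime_zero_left] at hr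
    omega
  | one => rw [pow_one]
  | prime_mul q s hq ih =>
    rw [pow_mul, ih (Nat.Coprime.coprime_mul_left hr)]
    have hqG : q.Coprime (Nat.card G) := Nat.Coprime.coprime_mul_right hr
    have := Fact.mk hq
    have hq2 : q ≠ 2 := by
      rintro rfl
      exact (Nat.Prime.coprime_iff_not_dvd hq).1 hqG h2
    obtain ⟨m, hm⟩ : Odd q := hq.odd_of_ne_two hq2
    obtain ⟨c', hc'⟩ := exists_frobenius_fiber_sum _ _ c hauto q hq 1 m (by rw [pow_one, hm])
    have hunit : (((2 * p : ℤ) ^ 2 : ℤ) : ZMod q) ^ m = 1 := by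
      push_cast
      rw [← pow_mul, show 2 * m = q - 1 by omega]
      apply ZMod.pow_card_sub_one_eq_one
      rw [show (2 : ZMod q) * p = ((2 * p : ℕ) : ZMod q) by push_cast; ring, Ne,
        ZMod.natCast_eq_zero_iff]
      intro h
      rcases (Nat.Prime.dvd_mul hq).1 h with h | h
      · exact (Nat.Prime.coprime_iff_not_dvd hq).1 hqG (h.trans h2)
      · exact (Nat.Prime.coprime_iff_not_dvd hq).1 hqG (h.trans hpG)
    have hfib : ∀ u : G, (shiftedIndicator D u : ZMod q) = shiftedIndicator D (u ^ q) + c' := by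
      intro u
      have h := hc' (u ^ q)
      rw [hunit, one_mul, pow_one] at h
      rw [← h, Finset.sum_eq_single_of_mem u (by simp)]
      intro w hw hwu
      exact absurd ((powCoprime hqG.symm).injective (by simpa using hw)) hwu
    have hc0 : c' = 0 := by simpa using hfib 1
    have hmod := hfib g
    rw [hc0, add_zero, ZMod.intCast_eq_intCast_iff_dvd_sub] at hmod
    have hq3 : 3 ≤ q := by have := hq.two_le; omega
    by_contra hne
    have habs := Int.le_of_dvd (abs_pos.2 (sub_ne_zero.2 hne)) ((dvd_abs _ _).2 hmod)
    have hbound : ∀ u : G, |shiftedIndicator D u| ≤ 1 := by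
      intro u
      unfold shiftedIndicator
      split_ifs <;> simp
    have := abs_sub (shiftedIndicator D (g ^ q)) (shiftedIndicator D g)
    have h3 := hbound g
    have h4 := hbound (g ^ q)
    omega

end Multiplier

section PrimaryProjection

omit [DecidableEq G] in
/-- In an abelian group of order `8p³` the `p⁴`-power map kills exactly the Sylow `p`-subgroup and
its image has order `8`. -/
theorem card_ker_range_powMonoidHom (p : ℕ) (hp : p.Prime) (hp2 : p ≠ 2)
    (hG : Nat.card G = 8 * p ^ 3) :
    Nat.card (powMonoidHom (p ^ 4) : G →* G).ker = p ^ 3 ∧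
      Nat.card (powMonoidHom (p ^ 4) : G →* G).range = 8 := by
  have := Fact.mk hp
  have := Fact.mk Nat.prime_two
  have hcop : Nat.Coprime 2 p := (Nat.coprime_primes Nat.prime_two hp).2 hp2.symm
  have hker : IsPGroup p (powMonoidHom (p ^ 4) : G →* G).ker := by
    rintro ⟨x, hx⟩
    refine ⟨4, Subtype.ext ?_⟩
    exact hx
  have hrange : IsPGroup 2 (powMonoidHom (p ^ 4) : G →* G).range := by
    rintro ⟨_, x, rfl⟩
    refine ⟨3, Subtype.ext ?_⟩
    change (x ^ p ^ 4) ^ 2 ^ 3 = 1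
    rw [← pow_mul, show p ^ 4 * 2 ^ 3 = Nat.card G * p by rw [hG]; ring, pow_mul,
      pow_card_eq_one', one_pow]
  obtain ⟨k, hk⟩ := IsPGroup.iff_card.1 hker
  obtain ⟨j, hj⟩ := IsPGroup.iff_card.1 hrange
  have hmul := Subgroup.card_mul_index (powMonoidHom (p ^ 4) : G →* G).ker
  rw [Subgroup.index_ker, hk, hj, hG] at hmul
  have h1 : p ^ k = p ^ 3 := by
    apply Nat.dvd_antisymm
    · exact (Nat.Coprime.dvd_of_dvd_mul_left
        (Nat.Coprime.pow_left k (Nat.Coprime.pow_right 3 hcop.symm) : Nat.Coprime (p ^ k) (2 ^ 3)))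
        ⟨2 ^ j, by rw [hmul]; norm_num⟩
    · exact (Nat.Coprime.dvd_of_dvd_mul_right
        (Nat.Coprime.pow_left 3 (Nat.Coprime.pow_right j hcop.symm) : Nat.Coprime (p ^ 3) (2 ^ j)))
        ⟨8, by rw [hmul]; ring⟩
  refine ⟨hk.trans h1, hj.trans ?_⟩
  rw [h1, mul_comm] at hmul
  exact Nat.eq_of_mul_eq_mul_right (pow_pos hp.pos 3) hmul

/-- The square sum of the fiber sums of `e` is a sum of its autocorrelations over the kernel. -/
theorem sum_sq_sum_fiber_eq (f : G →* G) (e : G → ℤ) (S : Finset G) (hS : ∀ g, f g ∈ S) :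
    ∑ h ∈ S, (∑ g with f g = h, e g) ^ 2 = ∑ u with f u = 1, ∑ g, e g * e (g * u) := by
  have h1 : ∀ h, (∑ g with f g = h, e g) ^ 2 = ∑ g with f g = h, e g * ∑ w with f w = f g, e w := by
    intro h
    rw [pow_two, Finset.sum_mul]
    refine Finset.sum_congr rfl fun g hg => ?_
    rw [(Finset.mem_filter.1 hg).2]
  simp_rw [h1]
  rw [Finset.sum_fiberwise_of_maps_to (fun g _ => hS g), Finset.sum_comm]
  refine Finset.sum_congr rfl fun g _ => ?_
  rw [← Finset.mul_sum]
  congr 1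
  refine Finset.sum_bij' (fun w _ => g⁻¹ * w) (fun u _ => g * u) ?_ ?_ ?_ ?_ ?_ <;>
    simp +contextual

/-- In the coset of the Sylow `p`-subgroup through a `2`-element `h`, the points of `D` other than `h`
fall into orbits of length `p - 1` of a multiplier. -/
theorem sub_one_dvd_card_fiber (p : ℕ) (hp : p.Prime) (hp2 : p ≠ 2) (hG : Nat.card G = 8 * p ^ 3)
    (D : Finset G) (hD : ∀ r : ℕ, r.Coprime (Nat.card G) → ∀ g ∈ D, g ^ r ∈ D)
    (h : G) (h8 : h ^ 8 = 1) (hh : h ^ p ^ 4 = h) :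
    p - 1 ∣ (Finset.univ.filter fun g => g ^ p ^ 4 = h ∧ g ≠ h ∧ g ∈ D).card := by
  obtain ⟨r, hrcop, hr8, hrpow, hrfree⟩ := exists_teichmuller_exponent p hp hp2
  rw [← hG] at hrcop hrpow
  have hhr : ∀ i, h ^ r ^ i = h := fun i => by
    have : r ^ i ≡ 1 [MOD orderOf h] :=
      (by simpa using hr8.pow i : r ^ i ≡ 1 [MOD 8]).of_dvd (orderOf_dvd_of_pow_eq_one h8)
    simpa using (pow_eq_pow_iff_modEq (x := h)).2 this
  have hinj : Function.Injective fun g : G => g ^ r := (powCoprime hrcop.symm).injective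
  let f : {g : G // g ^ p ^ 4 = h ∧ g ≠ h ∧ g ∈ D} → {g : G // g ^ p ^ 4 = h ∧ g ≠ h ∧ g ∈ D} :=
    fun g => ⟨g.1 ^ r, by
      have hhr1 : h ^ r = h := by simpa using hhr 1
      refine ⟨by rw [← pow_mul, mul_comm, pow_mul, g.2.1, hhr1], fun heq => g.2.2.1 ?_,
        hD r hrcop _ g.2.2.2⟩
      exact hinj (heq.trans hhr1.symm)⟩
  have hf : ∀ i g, ((f^[i] g : {g : G // g ^ p ^ 4 = h ∧ g ≠ h ∧ g ∈ D}) : G) = g.1 ^ r ^ i := by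
    intro i g
    induction i with
    | zero => simp
    | succ i ih =>
      rw [Function.iterate_succ_apply']
      exact (congrArg (· ^ r) ih).trans (by rw [pow_succ r i, pow_mul])
  rw [← Fintype.card_subtype]
  refine dvd_card_of_iterate_eq_self_iff f (p - 1) (by have := hp.two_le; omega) ?_ ?_
  · intro g
    apply Subtype.ext
    rw [hf]
    have : r ^ (p - 1) ≡ 1 [MOD orderOf g.1] := hrpow.of_dvd (orderOf_dvd_natCard _)
    simpa using (pow_eq_pow_iff_modEq (x := g.1)).2 this
  · intro g i hi
    apply hrfree
    have hgi : g.1 ^ r ^ i = g.1 := by rw [← hf, hi]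
    have hu : (g.1 * h⁻¹) ^ r ^ i = (g.1 * h⁻¹) ^ 1 := by
      rw [mul_pow, inv_pow, hgi, hhr, pow_one]
    have hmod := pow_eq_pow_iff_modEq.1 hu
    refine hmod.of_dvd ?_
    have hord : orderOf (g.1 * h⁻¹) ∣ p ^ 4 := by
      apply orderOf_dvd_of_pow_eq_one
      rw [mul_pow, inv_pow, g.2.1, hh, mul_inv_cancel]
    obtain ⟨k, -, hk⟩ := (Nat.dvd_prime_pow hp).1 hord
    rw [hk]
    refine dvd_pow_self p ?_
    rintro rfl
    rw [pow_zero, orderOf_eq_one_iff, mul_inv_eq_one] at hk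
    exact g.2.2.1 hk

end PrimaryProjection

/-- There is no regular `(8p³, 4p²+2p+1, 2p+4, 2p+2)`-PDS in an abelian group when `p ≥ 5`. -/
theorem not_isPDS_of_isRegularPDS (p : ℕ) (hp : p.Prime) (hp5 : 5 ≤ p) (D : Finset G)
    (hreg : IsRegularPDS D) :
    ¬ IsPDS D (8 * p ^ 3) (4 * p ^ 2 + 2 * p + 1) (2 * p + 4) (2 * p + 2) := by
  intro hPDS
  have := Fact.mk hp
  have hodd : Odd p := hp.odd_of_ne_two (by omega)
  have hG : Nat.card G = 8 * p ^ 3 := by rw [Nat.card_eq_fintype_card, hPDS.1]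
  have hauto : ∀ x, ∑ g, shiftedIndicator D g * shiftedIndicator D (g⁻¹ * x) =
      (if x = 1 then (2 * p : ℤ) ^ 2 else 0) + (2 * p + 2 : ℕ) := by
    intro x
    rw [shiftedIndicator_autocorrelation hPDS hreg]
    congr 2
    push_cast
    ring
  have hmult := shiftedIndicator_pow p _ (hG ▸ (by norm_num : 2 ∣ 8).mul_right _)
    (hG ▸ (dvd_pow_self p (by norm_num)).mul_left _) hauto
  have hDpow : ∀ r : ℕ, r.Coprime (Nat.card G) → ∀ g ∈ D, g ^ r ∈ D := by
    intro r hr g hg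
    have hg1 : g ≠ 1 := fun h => hreg.2 (h ▸ hg)
    have hgr : g ^ r ≠ 1 := fun h =>
      hg1 ((powCoprime hr.symm).injective (by simpa using h))
    have := hmult r hr g
    rw [shiftedIndicator_of_ne_one D hg1, shiftedIndicator_of_ne_one D hgr, if_pos hg] at this
    by_contra hgD
    simp [hgD] at this
  obtain ⟨hkercard, hrangecard⟩ := card_ker_range_powMonoidHom p hp (by omega) hG
  set f : G →* G := powMonoidHom (p ^ 4) with hf
  have hfapp : ∀ g, f g = g ^ p ^ 4 := fun g => rfl
  let S : Finset G := Finset.univ.image f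
  have hS : ∀ g, f g ∈ S := fun g => Finset.mem_image_of_mem f (Finset.mem_univ g)
  have hScard : S.card = 8 := by
    rw [← hrangecard, ← Nat.card_eq_finsetCard]
    refine Nat.card_congr (Equiv.subtypeEquivRight fun x => ?_)
    simp [S]
  have hS8 : ∀ h ∈ S, h ^ 8 = 1 := by
    intro h hh
    obtain ⟨g, -, rfl⟩ := Finset.mem_image.1 hh
    rw [hfapp, ← pow_mul, show p ^ 4 * 8 = Nat.card G * p by rw [hG]; ring, pow_mul,
      pow_card_eq_one', one_pow]
  have hp4 : p ^ 4 ≡ 1 [MOD 8] := by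
    have hlt : p % 8 < 8 := Nat.mod_lt _ (by norm_num)
    have hp8 : p % 8 % 2 = 1 := by rw [Nat.mod_mod_of_dvd _ (by norm_num)]; exact Nat.odd_iff.1 hodd
    rw [Nat.ModEq, Nat.pow_mod]
    interval_cases p % 8 <;> simp_all
  have hSfix : ∀ h ∈ S, h ^ p ^ 4 = h := fun h hh => by
    simpa using (pow_eq_pow_iff_modEq (x := h)).2
      (hp4.of_dvd (orderOf_dvd_of_pow_eq_one (hS8 h hh)))
  let b : G → ℤ := fun h => ∑ g with f g = h, shiftedIndicator D g
  have hbp : ∀ h, (p : ℤ) ∣ b h := by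
    obtain ⟨m, hm⟩ := hodd.pow (n := 4)
    obtain ⟨c', hc'⟩ := exists_frobenius_fiber_sum _ _ _ hauto p hp 4 m hm
    have hm0 : m ≠ 0 := by
      rintro rfl
      have : 1 < p ^ 4 := Nat.one_lt_pow (by norm_num) (by omega)
      omega
    have hb : ∀ h, (b h : ZMod p) = c' := by
      intro h
      have := hc' h
      simp only [Int.cast_pow, Int.cast_mul, Int.cast_natCast, CharP.cast_eq_zero, mul_zero,
        ne_eq, OfNat.ofNat_ne_zero, not_false_eq_true, zero_pow, hm0, zero_mul, zero_add] at this
      rw [← this]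
      simp [b, hfapp]
    have hSne : ∃ h, h ∉ S := by
      by_contra! hall
      have huniv : S = Finset.univ := Finset.eq_univ_of_forall hall
      rw [huniv, Finset.card_univ, hPDS.1] at hScard
      have : 1 < p ^ 3 := Nat.one_lt_pow (by norm_num) (by omega)
      omega
    obtain ⟨h₀, hh₀⟩ := hSne
    have hc0 : c' = 0 := by
      rw [← hb h₀]
      simp only [b]
      rw [Finset.filter_false_of_mem, Finset.sum_empty, Int.cast_zero]
      rintro g - rfl
      exact hh₀ (hS g)
    intro h
    rw [← ZMod.intCast_zmod_eq_zero_iff_dvd, hb, hc0]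
  have hbmod : ∀ h ∈ S, ((p : ℤ) - 1) ∣ b h - shiftedIndicator D h := by
    intro h hh
    have hmem : h ∈ Finset.univ.filter fun g => f g = h := by simp [hfapp, hSfix h hh]
    have hsub : b h - shiftedIndicator D h =
        (Finset.univ.filter fun g => g ^ p ^ 4 = h ∧ g ≠ h ∧ g ∈ D).card := by
      simp only [b]
      rw [← Finset.add_sum_erase _ _ hmem, add_sub_cancel_left, Finset.card_filter, Nat.cast_sum]
      rw [← Finset.filter_ne', Finset.filter_filter, Finset.sum_filter]
      refine Finset.sum_congr rfl fun g _ => ?_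
      by_cases hgh : f g = h ∧ g ≠ h
      · have hg1 : g ≠ 1 := by
          rintro rfl
          exact hgh.2 (by rw [← hgh.1, map_one])
        have hgh' := hgh
        rw [hfapp] at hgh'
        rw [if_pos hgh, shiftedIndicator_of_ne_one D hg1]
        simp [hgh'.1, hgh'.2]
      · rw [if_neg hgh, if_neg (fun h' => hgh ⟨h'.1, h'.2.1⟩), Nat.cast_zero]
    rw [hsub, show (p : ℤ) - 1 = ((p - 1 : ℕ) : ℤ) by push_cast [hp.one_le]; ring,
      Int.natCast_dvd_natCast]
    exact sub_one_dvd_card_fiber p hp (by omega) hG D hDpow h (hS8 h hh) (hSfix h hh)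
  have hy : ∀ h, ∃ y : ℤ, h ∈ S → b h = p * (shiftedIndicator D h + (p - 1) * y) := by
    intro h
    by_cases hh : h ∈ S
    · obtain ⟨x, hx⟩ := hbp h
      obtain ⟨z, hz⟩ := hbmod h hh
      refine ⟨z - x, fun _ => ?_⟩
      rw [hx] at hz ⊢
      congr 1
      linear_combination hz
    · exact ⟨0, fun h' => absurd h' hh⟩
  choose y hy using hy
  have hp0 : (p : ℤ) ≠ 0 := by exact_mod_cast hp.ne_zero
  refine not_exists_coset_distribution S 1 (by simpa using hS 1) hScard (shiftedIndicator D) y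
    (p - 1) (by omega) (by obtain ⟨k, rfl⟩ := hodd; exact ⟨k, by push_cast; ring⟩)
    (shiftedIndicator_one hreg.2) ?_ ?_ ?_
  · intro h _ hh1
    rw [shiftedIndicator_of_ne_one D hh1]
    split_ifs <;> simp
  · apply mul_left_cancel₀ hp0
    rw [Finset.mul_sum, ← Finset.sum_congr rfl (fun h hh => hy h hh)]
    simp only [b]
    rw [Finset.sum_fiberwise_of_maps_to (fun g _ => hS g), sum_shiftedIndicator, hPDS.2.1]
    push_cast
    ring
  · apply mul_left_cancel₀ (pow_ne_zero 2 hp0)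
    rw [Finset.mul_sum]
    simp_rw [← mul_pow]
    rw [← Finset.sum_congr rfl (fun h hh => congrArg (· ^ 2) (hy h hh))]
    simp only [b]
    rw [sum_sq_sum_fiber_eq f _ S hS]
    have hker : (Finset.univ.filter fun u => f u = 1).card = p ^ 3 := by
      rw [← hkercard, ← Fintype.card_subtype, ← Nat.card_eq_fintype_card]
      rfl
    have hconv : ∀ u, ∑ g, shiftedIndicator D g * shiftedIndicator D (g * u) =
        (if u = 1 then (2 * p : ℤ) ^ 2 else 0) + (2 * p + 2 : ℕ) := by
      intro u
      rw [← hauto u]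
      refine Fintype.sum_equiv (Equiv.inv G) _ _ fun g => ?_
      simp [shiftedIndicator_inv hreg]
    simp_rw [hconv]
    rw [Finset.sum_add_distrib, Finset.sum_ite_eq', if_pos (by simp), Finset.sum_const, hker,
      nsmul_eq_mul]
    push_cast
    ring

/-- A nontrivial regular `(8p^3, 4p^2+2p+1, 2p+4, 2p+2)`-PDS contains either
`3` or `7` elements of order `2`. -/
theorem pds_case2_involutions (p : ℕ) (hp : p.Prime) (hp5 : 5 ≤ p)
    {G : Type*} [CommGroup G] [DecidableEq G] [Fintype G]
    (D : Finset G)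
    (hPDS : IsPDS D (8 * p ^ 3) (4 * p ^ 2 + 2 * p + 1) (2 * p + 4) (2 * p + 2))
    (hreg : IsRegularPDS D) (hnt : ¬ IsTrivialPDS D) :
    (D.filter (fun x => orderOf x = 2)).card = 3 ∨
      (D.filter (fun x => orderOf x = 2)).card = 7 := by
  exact absurd hPDS (not_isPDS_of_isRegularPDS p hp hp5 D hreg)
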